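/- arXiv:2308.10387 — 2 statements merged into one kernel-verified Lean document; each statement's English description precedes it below -/
import Mathlib

section
/- For all 1 ≤ k ≤ n−1 and 1 ≤ i, j ≤ n, one has g_k·B'_{i,j} = B'_{s_k(i),s_k(j)}·g_k and T_k·B'_{i,j} = B'_{s_k(i),s_k(j)}·T_k + (B'_{s_k(i),s_k(j)} − B'_{i,j})·B'_{k,k+1} in H_{n,r}, where s_k is the transposition of k and k+1. -/
open Polynomial

namespace MAK

noncomputable section

variable (R : Type*) [CommRing R] (n r : ℕ) (q Δ : Rˣ) (u : Fin r → R) (F : Fin r → R[X])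

/-- The free `R`-algebra on generators `t_1, …, t_n` (left) and `T_1, …, T_{n-1}` (right). -/
abbrev FA := FreeAlgebra R (Fin n ⊕ Fin (n - 1))

/-- The generators `t_i`. -/
def tf (i : Fin n) : FA R n := FreeAlgebra.ι R (Sum.inl i)

/-- The generators `T_j`. -/
def Tf (j : Fin (n - 1)) : FA R n := FreeAlgebra.ι R (Sum.inr j)

/-- The index `j`, viewed in `Fin n`. -/
def lo (j : Fin (n - 1)) : Fin n := ⟨j.1, by have := j.2; omega⟩

/-- The index `j + 1`, viewed in `Fin n`. -/
def hi (j : Fin (n - 1)) : Fin n := ⟨j.1 + 1, by have := j.2; omega⟩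

/-- The element `B_j = Δ⁻² Σ_{c1<c2} (u_{c2} - u_{c1})(q - q⁻¹) F_{c1}(t_j) F_{c2}(t_{j+1})`. -/
def Bel (j : Fin (n - 1)) : FA R n :=
  ∑ c2 : Fin r, ∑ c1 ∈ Finset.univ.filter (fun c1 => c1 < c2),
    (((Δ⁻¹ : Rˣ) : R) ^ 2 * ((u c2 - u c1) * ((q : R) - ((q⁻¹ : Rˣ) : R)))) •
      (aeval (tf R n (lo n j)) (F c1) * aeval (tf R n (hi n j)) (F c2))

/-- The defining relations of the modified Ariki-Koike algebra. -/
inductive Rel : FA R n → FA R n → Prop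
  | quad (j : Fin (n - 1)) :
      Rel ((Tf R n j - algebraMap R (FA R n) (q : R)) *
        (Tf R n j + algebraMap R (FA R n) ((q⁻¹ : Rˣ) : R))) 0
  | tord (i : Fin n) : Rel (aeval (tf R n i) (∏ c : Fin r, (X - C (u c)))) 0
  | braid (j k : Fin (n - 1)) (h : k.1 = j.1 + 1) :
      Rel (Tf R n j * Tf R n k * Tf R n j) (Tf R n k * Tf R n j * Tf R n k)
  | Tcomm (j k : Fin (n - 1)) (h : j.1 + 2 ≤ k.1 ∨ k.1 + 2 ≤ j.1) :
      Rel (Tf R n j * Tf R n k) (Tf R n k * Tf R n j)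
  | tcomm (i i' : Fin n) : Rel (tf R n i * tf R n i') (tf R n i' * tf R n i)
  | Tt (j : Fin (n - 1)) (i : Fin n) (h1 : i ≠ lo n j) (h2 : i ≠ hi n j) :
      Rel (Tf R n j * tf R n i) (tf R n i * Tf R n j)
  | Thi (j : Fin (n - 1)) :
      Rel (Tf R n j * tf R n (hi n j)) (tf R n (lo n j) * Tf R n j + Bel R n r q Δ u F j)
  | Tlo (j : Fin (n - 1)) :
      Rel (Tf R n j * tf R n (lo n j)) (tf R n (hi n j) * Tf R n j - Bel R n r q Δ u F j)

/-- The modified Ariki-Koike algebra `H_{n,r}(R, q, u_1, …, u_r)`. -/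
abbrev Hnr := RingQuot (Rel R n r q Δ u F)

/-- The canonical projection. -/
def pim : FA R n →ₐ[R] Hnr R n r q Δ u F := RingQuot.mkAlgHom R (Rel R n r q Δ u F)

/-- The generator `t_i` of `H_{n,r}`. -/
def tt (i : Fin n) : Hnr R n r q Δ u F := pim R n r q Δ u F (tf R n i)

/-- The generator `T_j` of `H_{n,r}`. -/
def TT (j : Fin (n - 1)) : Hnr R n r q Δ u F := pim R n r q Δ u F (Tf R n j)

/-- The Lagrange basis polynomial `∏_{j ≠ c} (X - u_j)/(u_c - u_j)`. -/
def bpoly (c : Fin r) : R[X] :=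
  ∏ j ∈ Finset.univ.filter (fun j => j ≠ c), Ring.inverse (u c - u j) • (X - C (u j))

/-- The idempotent `b_{k_1, …, k_n}`. -/
def b (k : Fin n → Fin r) : Hnr R n r q Δ u F :=
  (List.ofFn fun i : Fin n => aeval (tt R n r q Δ u F i) (bpoly R r u (k i))).prod

/-- The element `B'_{i,j} = -(q - q⁻¹) Σ_{k_i < k_j} b_{k_1, …, k_n}`. -/
def B' (i j : Fin n) : Hnr R n r q Δ u F :=
  -(((q : R) - ((q⁻¹ : Rˣ) : R)) •
    ∑ k ∈ Finset.univ.filter (fun k : Fin n → Fin r => k i < k j), b R n r q Δ u F k)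

/-- The element `g_i := T_i + B'_{i,i+1}`. -/
def g (j : Fin (n - 1)) : Hnr R n r q Δ u F :=
  TT R n r q Δ u F j + B' R n r q Δ u F (lo n j) (hi n j)

/-- The idempotent `e_{i,j} = Σ_{k_i = k_j} b_{k_1, …, k_n}`. -/
def eij (i j : Fin n) : Hnr R n r q Δ u F :=
  ∑ k ∈ Finset.univ.filter (fun k : Fin n → Fin r => k i = k j), b R n r q Δ u F k

/-- The idempotent `e_i = e_{i,i+1}`. -/
def ee (j : Fin (n - 1)) : Hnr R n r q Δ u F := eij R n r q Δ u F (lo n j) (hi n j)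

/-- The simple transposition `s_j = (j, j+1)` in `S_n`. -/
def simple (j : Fin (n - 1)) : Equiv.Perm (Fin n) := Equiv.swap (lo n j) (hi n j)

/-- `l` is a reduced word for the permutation `w`. -/
def IsReducedWord (w : Equiv.Perm (Fin n)) (l : List (Fin (n - 1))) : Prop :=
  (l.map (simple n)).prod = w ∧
    ∀ l' : List (Fin (n - 1)), (l'.map (simple n)).prod = w → l.length ≤ l'.length

/-- The element `g_w = g_{i_1} ⋯ g_{i_l}` associated to a word `l = (i_1, …, i_l)`. -/
def gword (l : List (Fin (n - 1))) : Hnr R n r q Δ u F := (l.map (g R n r q Δ u F)).prod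

/-- The element `T_w = T_{i_1} ⋯ T_{i_l}` associated to a word `l = (i_1, …, i_l)`. -/
def Tword (l : List (Fin (n - 1))) : Hnr R n r q Δ u F := (l.map (TT R n r q Δ u F)).prod

/-- The monomial `t_1^{c_1} ⋯ t_n^{c_n}`. -/
def tmon (c : Fin n → ℕ) : Hnr R n r q Δ u F :=
  (List.ofFn fun i : Fin n => tt R n r q Δ u F i ^ c i).prod

end

end MAK

open MAK

/-- Pairwise commuting elements of an algebra admit an evaluation map from the polynomial ring. -/
theorem exists_mvPolynomial_algHom_of_commute {R A ι : Type*} [CommRing R] [Ring A] [Algebra R A]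
    (x : ι → A) (hx : ∀ i j, x i * x j = x j * x i) :
    ∃ φ : MvPolynomial ι R →ₐ[R] A, ∀ i, φ (MvPolynomial.X i) = x i := by
  have hcomm : IsMulCommutative (Algebra.adjoin R (Set.range x)) :=
    Algebra.isMulCommutative_adjoin R (by rintro _ ⟨i, rfl⟩ _ ⟨j, rfl⟩; exact hx i j)
  let : CommRing (Algebra.adjoin R (Set.range x)) :=
    { (inferInstance : Ring (Algebra.adjoin R (Set.range x))) with
      mul_comm := fun a b => hcomm.is_comm.comm a b }
  refine ⟨(Algebra.adjoin R (Set.range x)).val.comp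
    (MvPolynomial.aeval fun i => ⟨x i, Algebra.subset_adjoin ⟨i, rfl⟩⟩), fun i => ?_⟩
  simp

/-- An element intertwining the values of the variables with their permuted values intertwines
the values of all polynomials. -/
theorem mul_eq_rename_mul {R A ι : Type*} [CommRing R] [Ring A] [Algebra R A]
    (φ : MvPolynomial ι R →ₐ[R] A) (s : ι → ι) (y : A)
    (hy : ∀ i, y * φ (MvPolynomial.X i) = φ (MvPolynomial.X (s i)) * y)
    (P : MvPolynomial ι R) : y * φ P = φ (MvPolynomial.rename s P) * y := by
  induction P using MvPolynomial.induction_on with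
  | C a =>
    rw [MvPolynomial.rename_C, ← MvPolynomial.algebraMap_eq, AlgHom.commutes]
    exact (Algebra.commutes a y).symm
  | add P Q hP hQ => rw [map_add, map_add, map_add, mul_add, add_mul, hP, hQ]
  | mul_X P i hP =>
    rw [map_mul, map_mul, map_mul, MvPolynomial.rename_X, ← mul_assoc, hP, mul_assoc, hy,
      mul_assoc]

namespace MAK

section

variable (R : Type*) [CommRing R] (n r : ℕ) (q Δ : Rˣ) (u : Fin r → R) (F : Fin r → R[X])

theorem X_sub_C_mul_bpoly (c : Fin r) :
    ∃ a : R, (X - C (u c)) * bpoly R r u c = a • ∏ d : Fin r, (X - C (u d)) := by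
  refine ⟨∏ j ∈ Finset.univ.filter (fun j => j ≠ c), Ring.inverse (u c - u j), ?_⟩
  rw [bpoly, Finset.prod_smul, mul_smul_comm, Finset.filter_ne', Finset.mul_prod_erase _
    (fun d => X - C (u d)) (Finset.mem_univ c)]

theorem isUnit_sub_of_ne
    (hΔ : (Δ : R) = ∏ i : Fin r, ∏ j ∈ Finset.univ.filter (fun j => j < i), (u i - u j))
    {c d : Fin r} (h : c ≠ d) : IsUnit (u c - u d) := by
  have key : ∀ {c d : Fin r}, d < c → IsUnit (u c - u d) := fun {c d} h =>
    isUnit_of_dvd_unit (hΔ ▸ (Finset.dvd_prod_of_mem (fun j => u c - u j)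
      (Finset.mem_filter.2 ⟨Finset.mem_univ d, h⟩)).trans
        (Finset.dvd_prod_of_mem (fun i => ∏ j ∈ Finset.univ.filter (fun j => j < i), (u i - u j))
          (Finset.mem_univ c))) Δ.isUnit
  rcases lt_or_gt_of_ne h with h | h
  · rw [← neg_sub]; exact (key h).neg
  · exact key h

theorem eval_bpoly
    (hΔ : (Δ : R) = ∏ i : Fin r, ∏ j ∈ Finset.univ.filter (fun j => j < i), (u i - u j))
    (c d : Fin r) : (bpoly R r u c).eval (u d) = if d = c then 1 else 0 := by
  rw [bpoly, eval_prod]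
  split_ifs with h
  · subst h
    refine Finset.prod_eq_one fun j hj => ?_
    rw [eval_smul, eval_sub, eval_X, eval_C, smul_eq_mul]
    exact Ring.inverse_mul_cancel _
      (isUnit_sub_of_ne R r Δ u hΔ (Ne.symm (Finset.mem_filter.1 hj).2))
  · exact Finset.prod_eq_zero (Finset.mem_filter.2 ⟨Finset.mem_univ d, h⟩) (by simp)

theorem degree_bpoly_lt (c : Fin r) : (bpoly R r u c).degree < r := by
  have hr : 1 ≤ r := c.pos
  refine (degree_prod_le _ _).trans_lt ?_
  refine (Finset.sum_le_card_nsmul _ _ 1 fun j _ =>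
    (degree_smul_le _ _).trans (degree_X_sub_C_le _)).trans_lt ?_
  rw [Finset.filter_ne', Finset.card_erase_of_mem (Finset.mem_univ c), Finset.card_univ,
    Fintype.card_fin, nsmul_one]
  exact_mod_cast Nat.sub_lt hr one_pos

theorem sum_bpoly [IsDomain R] (hr : 1 ≤ r)
    (hΔ : (Δ : R) = ∏ i : Fin r, ∏ j ∈ Finset.univ.filter (fun j => j < i), (u i - u j)) :
    ∑ c, bpoly R r u c = 1 := by
  have hu : Set.InjOn u (Finset.univ : Finset (Fin r)) := fun c _ d _ h => by
    by_contra hcd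
    exact (isUnit_sub_of_ne R r Δ u hΔ hcd).ne_zero (sub_eq_zero.2 h)
  refine eq_of_degrees_lt_of_eval_index_eq Finset.univ hu ?_ ?_ fun d _ => ?_
  · rw [Finset.card_univ, Fintype.card_fin]
    refine (degree_sum_le _ _).trans_lt ((Finset.sup_lt_iff (WithBot.bot_lt_coe r)).2 ?_)
    exact fun c _ => degree_bpoly_lt R r u c
  · rw [Finset.card_univ, Fintype.card_fin, degree_one]
    exact_mod_cast hr
  · simp [eval_finsetSum, eval_bpoly R r Δ u hΔ]

/-- The polynomial in `n` commuting variables whose value at `t_1, …, t_n` is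
`b_{k_1, …, k_n}`. -/
noncomputable def bMv (k : Fin n → Fin r) : MvPolynomial (Fin n) R :=
  ∏ i, aeval (MvPolynomial.X i) (bpoly R r u (k i))

/-- The polynomial in `n` commuting variables whose value at `t_1, …, t_n` is `B'_{i,j}`. -/
noncomputable def BMv (i j : Fin n) : MvPolynomial (Fin n) R :=
  -(((q : R) - ((q⁻¹ : Rˣ) : R)) •
    ∑ k ∈ Finset.univ.filter (fun k : Fin n → Fin r => k i < k j), bMv R n r u k)

theorem rename_bMv (s : Equiv.Perm (Fin n)) (k : Fin n → Fin r) :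
    MvPolynomial.rename s (bMv R n r u k) = bMv R n r u (k ∘ s.symm) := by
  rw [bMv, bMv, map_prod, ← Equiv.prod_comp s (fun i => aeval _ (bpoly R r u _))]
  refine Finset.prod_congr rfl fun i _ => ?_
  rw [← aeval_algHom_apply, MvPolynomial.rename_X]
  simp

theorem rename_BMv (s : Equiv.Perm (Fin n)) (i j : Fin n) :
    MvPolynomial.rename s (BMv R n r q u i j) = BMv R n r q u (s i) (s j) := by
  simp only [BMv, map_neg, map_smul, map_sum, rename_bMv]
  congr 2
  refine Finset.sum_equiv (s.arrowCongr (Equiv.refl _)) (fun k => ?_) fun k _ => ?_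
  · simp
  · rfl

theorem sum_bMv [IsDomain R] (hr : 1 ≤ r)
    (hΔ : (Δ : R) = ∏ i : Fin r, ∏ j ∈ Finset.univ.filter (fun j => j < i), (u i - u j)) :
    ∑ k, bMv R n r u k = 1 := by
  have h := Finset.prod_univ_sum (fun _ : Fin n => (Finset.univ : Finset (Fin r)))
    (fun i c => aeval (MvPolynomial.X i : MvPolynomial (Fin n) R) (bpoly R r u c))
  rw [Fintype.piFinset_univ] at h
  simp only [bMv]
  rw [← h]
  refine Finset.prod_eq_one fun i _ => ?_
  rw [← map_sum, sum_bpoly R r Δ u hr hΔ, map_one]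

theorem pim_eq {a c : FA R n} (h : Rel R n r q Δ u F a c) :
    pim R n r q Δ u F a = pim R n r q Δ u F c :=
  RingQuot.mkAlgHom_rel R h

variable (φ : MvPolynomial (Fin n) R →ₐ[R] Hnr R n r q Δ u F)
  (hφ : ∀ i, φ (MvPolynomial.X i) = tt R n r q Δ u F i)

include hφ

theorem map_bMv (k : Fin n → Fin r) : φ (bMv R n r u k) = b R n r q Δ u F k := by
  rw [bMv, ← List.prod_ofFn, map_list_prod, List.map_ofFn, b]
  congr 2
  funext i
  rw [Function.comp_apply, ← aeval_algHom_apply, hφ]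

theorem map_BMv (i j : Fin n) : φ (BMv R n r q u i j) = B' R n r q Δ u F i j := by
  simp only [BMv, B', map_neg, map_smul, map_sum, map_bMv R n r q Δ u F φ hφ]

theorem tt_mul_b (i : Fin n) (k : Fin n → Fin r) :
    tt R n r q Δ u F i * b R n r q Δ u F k = u (k i) • b R n r q Δ u F k := by
  obtain ⟨a, ha⟩ := X_sub_C_mul_bpoly R r u (k i)
  have h0 : aeval (tt R n r q Δ u F i) (∏ c : Fin r, (X - C (u c))) = 0 := by
    have := pim_eq R n r q Δ u F (Rel.tord i)
    rwa [← aeval_algHom_apply, map_zero] at this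
  have h1 : φ ((MvPolynomial.X i - MvPolynomial.C (u (k i))) * bMv R n r u k) = 0 := by
    rw [bMv, ← Finset.mul_prod_erase _ _ (Finset.mem_univ i), ← mul_assoc, map_mul]
    have h2 : (MvPolynomial.X i - MvPolynomial.C (u (k i))) *
        aeval (MvPolynomial.X i : MvPolynomial (Fin n) R) (bpoly R r u (k i)) =
        aeval (MvPolynomial.X i) (a • ∏ d : Fin r, (X - C (u d))) := by
      rw [← ha, map_mul, map_sub, aeval_X, aeval_C, MvPolynomial.algebraMap_eq]
    rw [h2, ← aeval_algHom_apply, hφ, map_smul, h0, smul_zero, zero_mul]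
  rw [map_mul, map_sub, hφ, map_bMv R n r q Δ u F φ hφ, ← MvPolynomial.algebraMap_eq,
    AlgHom.commutes, sub_mul, sub_eq_zero, ← Algebra.smul_def] at h1
  exact h1

theorem aeval_tt_mul_b (f : R[X]) (i : Fin n) (k : Fin n → Fin r) :
    aeval (tt R n r q Δ u F i) f * b R n r q Δ u F k = f.eval (u (k i)) • b R n r q Δ u F k := by
  induction f using Polynomial.induction_on' with
  | add f g hf hg => rw [map_add, add_mul, hf, hg, eval_add, add_smul]
  | monomial m a =>
    rw [aeval_monomial, eval_monomial, mul_assoc, ← Algebra.smul_def, mul_smul]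
    congr 1
    induction m with
    | zero => simp
    | succ m ih =>
      rw [pow_succ, mul_assoc, tt_mul_b R n r q Δ u F φ hφ, mul_smul_comm, ih, smul_smul, pow_succ,
        mul_comm]

theorem pim_Bel_mul_b
    (hFeval : ∀ c c' : Fin r, (F c).eval (u c') = if c' = c then (Δ : R) else 0)
    (p : Fin (n - 1)) (k : Fin n → Fin r) :
    pim R n r q Δ u F (Bel R n r q Δ u F p) * b R n r q Δ u F k =
      if k (lo n p) < k (hi n p) then
        (((q : R) - ((q⁻¹ : Rˣ) : R)) * (u (k (hi n p)) - u (k (lo n p)))) • b R n r q Δ u F k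
      else 0 := by
  have h : ∀ c1 c2 : Fin r, pim R n r q Δ u F
      ((((Δ⁻¹ : Rˣ) : R) ^ 2 * ((u c2 - u c1) * ((q : R) - ((q⁻¹ : Rˣ) : R)))) •
      (aeval (tf R n (lo n p)) (F c1) * aeval (tf R n (hi n p)) (F c2))) * b R n r q Δ u F k =
      if c1 = k (lo n p) then if c2 = k (hi n p) then
        (((q : R) - ((q⁻¹ : Rˣ) : R)) * (u (k (hi n p)) - u (k (lo n p)))) • b R n r q Δ u F k
      else 0 else 0 := by
    intro c1 c2
    rw [map_smul, map_mul, ← aeval_algHom_apply, ← aeval_algHom_apply, smul_mul_assoc, mul_assoc]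
    change _ • (aeval (tt R n r q Δ u F _) _ * (aeval (tt R n r q Δ u F _) _ * _)) = _
    rw [aeval_tt_mul_b R n r q Δ u F φ hφ, mul_smul_comm, aeval_tt_mul_b R n r q Δ u F φ hφ,
      hFeval, hFeval, smul_smul, smul_smul]
    by_cases h1 : c1 = k (lo n p)
    · by_cases h2 : c2 = k (hi n p)
      · subst h1 h2
        simp only [if_true]
        congr 1
        have := Δ.inv_mul
        linear_combination (u (k (hi n p)) - u (k (lo n p))) * ((q : R) - ((q⁻¹ : Rˣ) : R)) *
          (((Δ⁻¹ : Rˣ) : R) * (Δ : R) + 1) * this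
      · simp [h2, Ne.symm h2]
    · simp [h1, Ne.symm h1]
  simp only [Bel, map_sum, Finset.sum_mul, h]
  simp [Finset.sum_filter, ← ite_and]
  rw [Finset.sum_eq_single (k (hi n p)) (fun c _ hc => by simp [hc]) (by simp),
    Finset.sum_eq_single (k (lo n p)) (fun c _ hc => by simp [hc]) (by simp)]
  simp

theorem pim_Bel [IsDomain R] (hr : 1 ≤ r)
    (hΔ : (Δ : R) = ∏ i : Fin r, ∏ j ∈ Finset.univ.filter (fun j => j < i), (u i - u j))
    (hFeval : ∀ c c' : Fin r, (F c).eval (u c') = if c' = c then (Δ : R) else 0)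
    (p : Fin (n - 1)) :
    pim R n r q Δ u F (Bel R n r q Δ u F p) =
      (tt R n r q Δ u F (lo n p) - tt R n r q Δ u F (hi n p)) *
        B' R n r q Δ u F (lo n p) (hi n p) := by
  have h1 : ∑ k, b R n r q Δ u F k = 1 := by
    simp only [← map_bMv R n r q Δ u F φ hφ]
    rw [← map_sum, sum_bMv R n r Δ u hr hΔ, map_one]
  have h2 : (tt R n r q Δ u F (lo n p) - tt R n r q Δ u F (hi n p)) *
      B' R n r q Δ u F (lo n p) (hi n p) =
      ∑ k ∈ Finset.univ.filter (fun k : Fin n → Fin r => k (lo n p) < k (hi n p)),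
        ((q : R) - ((q⁻¹ : Rˣ) : R)) •
          ((tt R n r q Δ u F (hi n p) - tt R n r q Δ u F (lo n p)) * b R n r q Δ u F k) := by
    simp only [← map_BMv R n r q Δ u F φ hφ, ← map_bMv R n r q Δ u F φ hφ, ← hφ, ← map_sub,
      ← map_mul, ← map_smul, ← map_sum]
    congr 1
    rw [BMv, mul_neg, ← neg_mul, neg_sub, mul_smul_comm, Finset.mul_sum, Finset.smul_sum]
  rw [← mul_one (pim R n r q Δ u F _), ← h1, Finset.mul_sum, h2, Finset.sum_filter]
  refine Finset.sum_congr rfl fun k _ => ?_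
  have h3 : (tt R n r q Δ u F (hi n p) - tt R n r q Δ u F (lo n p)) * b R n r q Δ u F k =
      (u (k (hi n p)) - u (k (lo n p))) • b R n r q Δ u F k := by
    rw [sub_mul, tt_mul_b R n r q Δ u F φ hφ, tt_mul_b R n r q Δ u F φ hφ, sub_eq_iff_eq_add,
      ← add_smul, sub_add_cancel]
  rw [pim_Bel_mul_b R n r q Δ u F φ hφ hFeval, h3, smul_smul]

theorem g_mul_tt [IsDomain R] (hr : 1 ≤ r)
    (hΔ : (Δ : R) = ∏ i : Fin r, ∏ j ∈ Finset.univ.filter (fun j => j < i), (u i - u j))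
    (hFeval : ∀ c c' : Fin r, (F c).eval (u c') = if c' = c then (Δ : R) else 0)
    (p : Fin (n - 1)) (i : Fin n) :
    g R n r q Δ u F p * tt R n r q Δ u F i =
      tt R n r q Δ u F (Equiv.swap (lo n p) (hi n p) i) * g R n r q Δ u F p := by
  have hB := pim_Bel R n r q Δ u F φ hφ hr hΔ hFeval p
  have hc : ∀ j, B' R n r q Δ u F (lo n p) (hi n p) * tt R n r q Δ u F j =
      tt R n r q Δ u F j * B' R n r q Δ u F (lo n p) (hi n p) := fun j => by
    rw [← map_BMv R n r q Δ u F φ hφ, ← hφ, ← map_mul, ← map_mul, mul_comm]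
  rw [g, add_mul, mul_add, hc]
  by_cases h1 : i = lo n p
  · subst h1
    have h := pim_eq R n r q Δ u F (Rel.Tlo p)
    rw [map_sub, map_mul, map_mul, hB] at h
    change TT R n r q Δ u F p * tt R n r q Δ u F _ =
      tt R n r q Δ u F _ * TT R n r q Δ u F p - _ at h
    rw [Equiv.swap_apply_left, h, sub_mul]
    abel
  · by_cases h2 : i = hi n p
    · subst h2
      have h := pim_eq R n r q Δ u F (Rel.Thi p)
      rw [map_add, map_mul, map_mul, hB] at h
      change TT R n r q Δ u F p * tt R n r q Δ u F _ =
        tt R n r q Δ u F _ * TT R n r q Δ u F p + _ at h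
      rw [Equiv.swap_apply_right, h, sub_mul]
      abel
    · have h := pim_eq R n r q Δ u F (Rel.Tt p i h1 h2)
      rw [map_mul, map_mul] at h
      change TT R n r q Δ u F p * tt R n r q Δ u F _ =
        tt R n r q Δ u F _ * TT R n r q Δ u F p at h
      rw [Equiv.swap_apply_of_ne_of_ne h1 h2, h]

end

end MAK

/-- Lemma 3.4: relations of `g_k` and `T_k` with the elements `B'_{i,j}`. -/
theorem statement4
    (R : Type*) [CommRing R] [IsDomain R] (n r : ℕ) (hn : 1 ≤ n) (hr : 1 ≤ r)
    (q Δ : Rˣ) (u : Fin r → R) (F : Fin r → R[X])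
    (hΔ : (Δ : R) = ∏ i : Fin r, ∏ j ∈ Finset.univ.filter (fun j => j < i), (u i - u j))
    (hFdeg : ∀ c : Fin r, (F c).degree = ((r - 1 : ℕ) : WithBot ℕ))
    (hFeval : ∀ c c' : Fin r, (F c).eval (u c') = if c' = c then (Δ : R) else 0)
    (p : Fin (n - 1)) (i j : Fin n) :
    g R n r q Δ u F p * B' R n r q Δ u F i j =
        B' R n r q Δ u F (Equiv.swap (lo n p) (hi n p) i) (Equiv.swap (lo n p) (hi n p) j) * g R n r q Δ u F p ∧
    TT R n r q Δ u F p * B' R n r q Δ u F i j =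
        B' R n r q Δ u F (Equiv.swap (lo n p) (hi n p) i) (Equiv.swap (lo n p) (hi n p) j) * TT R n r q Δ u F p +
          (B' R n r q Δ u F (Equiv.swap (lo n p) (hi n p) i) (Equiv.swap (lo n p) (hi n p) j) -
              B' R n r q Δ u F i j) * B' R n r q Δ u F (lo n p) (hi n p) := by
  obtain ⟨φ, hφ⟩ := exists_mvPolynomial_algHom_of_commute (R := R) (tt R n r q Δ u F) fun i j => by
    simpa only [tt, map_mul] using pim_eq R n r q Δ u F (Rel.tcomm i j)
  have hg : g R n r q Δ u F p * B' R n r q Δ u F i j =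
      B' R n r q Δ u F (Equiv.swap (lo n p) (hi n p) i) (Equiv.swap (lo n p) (hi n p) j) *
        g R n r q Δ u F p := by
    have h := mul_eq_rename_mul φ (Equiv.swap (lo n p) (hi n p)) (g R n r q Δ u F p)
      (fun i => by rw [hφ, hφ]; exact g_mul_tt R n r q Δ u F φ hφ hr hΔ hFeval p i)
      (BMv R n r q u i j)
    rwa [rename_BMv, map_BMv R n r q Δ u F φ hφ, map_BMv R n r q Δ u F φ hφ] at h
  refine ⟨hg, ?_⟩
  have hc : B' R n r q Δ u F i j * B' R n r q Δ u F (lo n p) (hi n p) =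
      B' R n r q Δ u F (lo n p) (hi n p) * B' R n r q Δ u F i j := by
    simp only [← map_BMv R n r q Δ u F φ hφ]
    rw [← map_mul, ← map_mul, mul_comm]
  rw [g, add_mul, mul_add] at hg
  rw [sub_mul, hc, eq_sub_of_add_eq hg]
  abel
end

section
/- For every w ∈ S_n, one has g_w ∈ T_w + Σ_{w' < w} R[t_1,…,t_n]·T_{w'}, where < denotes the Bruhat order on S_n; that is, g_w − T_w lies in the R[t_1,…,t_n]-span of the elements T_{w'} with w' strictly below w in Bruhat order. -/
open Polynomial

open MAK


namespace MAK

/-- The Bruhat order on `S_n`, via the subword property. -/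
def BruhatLE (n : ℕ) (w' w : Equiv.Perm (Fin n)) : Prop :=
  ∃ l : List (Fin (n - 1)), IsReducedWord n w l ∧
    ∃ l' : List (Fin (n - 1)), l'.Sublist l ∧ IsReducedWord n w' l'

/-- The strict Bruhat order on `S_n`. -/
def BruhatLT (n : ℕ) (w' w : Equiv.Perm (Fin n)) : Prop := BruhatLE n w' w ∧ w' ≠ w

end MAK

namespace MAK

section Words

variable {n : ℕ}

/-- The permutation represented by a word in the simple transpositions. -/
def wordPerm (l : List (Fin (n - 1))) : Equiv.Perm (Fin n) := (l.map (simple n)).prod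

/-- `j` is a left descent of `w`. -/
def IsLeftDescent (j : Fin (n - 1)) (w : Equiv.Perm (Fin n)) : Prop :=
  w⁻¹ (hi n j) < w⁻¹ (lo n j)

@[simp] lemma wordPerm_nil : wordPerm ([] : List (Fin (n - 1))) = 1 := rfl

@[simp] lemma wordPerm_cons (j : Fin (n - 1)) (l : List (Fin (n - 1))) :
    wordPerm (j :: l) = simple n j * wordPerm l := by simp [wordPerm]

lemma lo_lt_hi (j : Fin (n - 1)) : lo n j < hi n j := by simp [lo, hi, Fin.lt_def]

@[simp] lemma simple_mul_self (j : Fin (n - 1)) : simple n j * simple n j = 1 :=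
  Equiv.swap_mul_self _ _

@[simp] lemma simple_mul_simple_mul (j : Fin (n - 1)) (w : Equiv.Perm (Fin n)) :
    simple n j * (simple n j * w) = w := by
  rw [← mul_assoc, simple_mul_self, one_mul]

@[simp] lemma simple_inv (j : Fin (n - 1)) : (simple n j)⁻¹ = simple n j :=
  Equiv.swap_inv _ _

@[simp] lemma simple_lo (j : Fin (n - 1)) : simple n j (lo n j) = hi n j :=
  Equiv.swap_apply_left _ _

@[simp] lemma simple_hi (j : Fin (n - 1)) : simple n j (hi n j) = lo n j :=
  Equiv.swap_apply_right _ _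

lemma simple_lt_simple {k : Fin (n - 1)} {a b : Fin n} (hab : a < b)
    (hne : ¬(a = lo n k ∧ b = hi n k)) : simple n k a < simple n k b := by
  simp only [simple, Equiv.swap_apply_def, Fin.ext_iff, Fin.lt_def, lo, hi] at *
  split_ifs <;> simp_all <;> omega

/-- The strong exchange property for arbitrary words. -/
lemma exists_sublist_wordPerm_eq_swap_mul (l : List (Fin (n - 1))) :
    ∀ a b : Fin n, a < b → (wordPerm l)⁻¹ b < (wordPerm l)⁻¹ a →
      ∃ l' : List (Fin (n - 1)), l'.Sublist l ∧ l'.length + 1 = l.length ∧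
        wordPerm l' = Equiv.swap a b * wordPerm l := by
  induction l with
  | nil => intro a b hab h; simp at h; exact absurd hab h.asymm
  | cons k l ih =>
    intro a b hab h
    by_cases hk : a = lo n k ∧ b = hi n k
    · obtain ⟨rfl, rfl⟩ := hk
      exact ⟨l, List.sublist_cons_self _ _, rfl, by
        rw [wordPerm_cons]; exact (simple_mul_simple_mul k _).symm⟩
    · simp only [wordPerm_cons, mul_inv_rev, simple_inv, Equiv.Perm.mul_apply] at h
      obtain ⟨l', hs, hlen, hp⟩ := ih _ _ (simple_lt_simple hab hk) h
      refine ⟨k :: l', hs.cons_cons k, by simp [hlen], ?_⟩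
      rw [wordPerm_cons, hp, wordPerm_cons, ← mul_assoc, ← mul_assoc,
        Equiv.mul_swap_eq_swap_mul, ← Equiv.Perm.mul_apply, ← Equiv.Perm.mul_apply,
        simple_mul_self, Equiv.Perm.one_apply, Equiv.Perm.one_apply]

lemma IsReducedWord.of_length_le {w : Equiv.Perm (Fin n)} {l l' : List (Fin (n - 1))}
    (hl : IsReducedWord n w l) (hp : wordPerm l' = w) (hlen : l'.length ≤ l.length) :
    IsReducedWord n w l' :=
  ⟨hp, fun m hm => hlen.trans (hl.2 m hm)⟩

lemma isLeftDescent_simple_mul {j : Fin (n - 1)} {w : Equiv.Perm (Fin n)}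
    (h : ¬IsLeftDescent j w) : IsLeftDescent j (simple n j * w) := by
  simp only [IsLeftDescent, not_lt, mul_inv_rev, simple_inv, Equiv.Perm.mul_apply, simple_hi,
    simple_lo] at h ⊢
  exact lt_of_le_of_ne h fun e => (lo_lt_hi j).ne (w⁻¹.injective e)

lemma IsReducedWord.exists_of_isLeftDescent {j : Fin (n - 1)} {w : Equiv.Perm (Fin n)}
    {l : List (Fin (n - 1))} (hl : IsReducedWord n w l) (hj : IsLeftDescent j w) :
    ∃ l' : List (Fin (n - 1)), l'.Sublist l ∧ l'.length + 1 = l.length ∧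
      IsReducedWord n (simple n j * w) l' ∧ IsReducedWord n w (j :: l') := by
  obtain rfl : wordPerm l = w := hl.1
  obtain ⟨l', hs, hlen, hp⟩ := exists_sublist_wordPerm_eq_swap_mul l _ _ (lo_lt_hi j) hj
  change wordPerm l' = simple n j * wordPerm l at hp
  refine ⟨l', hs, hlen, ⟨hp, fun m hm => ?_⟩, hl.of_length_le (by simp [hp]) (by simp [hlen])⟩
  have := hl.2 (j :: m) (by
    change wordPerm m = _ at hm
    change wordPerm (j :: m) = _
    simp [hm])
  simp only [List.length_cons] at this
  omega

lemma IsReducedWord.cons {j : Fin (n - 1)} {w : Equiv.Perm (Fin n)}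
    {l : List (Fin (n - 1))} (hl : IsReducedWord n w l) (hj : ¬IsLeftDescent j w) :
    IsReducedWord n (simple n j * w) (j :: l) := by
  obtain rfl : wordPerm l = w := hl.1
  refine ⟨wordPerm_cons j l, fun m hm => ?_⟩
  change wordPerm m = _ at hm
  obtain ⟨m', -, hlen, hp⟩ := exists_sublist_wordPerm_eq_swap_mul m _ _ (lo_lt_hi j)
    (by rw [hm]; exact isLeftDescent_simple_mul hj)
  have := hl.2 m' (by
    change wordPerm m' = _
    rw [hp, hm]
    exact simple_mul_simple_mul j _)
  simp only [List.length_cons]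
  omega

lemma IsReducedWord.of_cons {j : Fin (n - 1)} {w : Equiv.Perm (Fin n)}
    {l : List (Fin (n - 1))} (hl : IsReducedWord n w (j :: l)) :
    IsLeftDescent j w ∧ IsReducedWord n (simple n j * w) l := by
  obtain rfl : wordPerm (j :: l) = w := hl.1
  constructor
  · by_contra hj
    have h := isLeftDescent_simple_mul hj
    rw [wordPerm_cons, simple_mul_simple_mul] at h
    obtain ⟨m, -, hlen, hp⟩ := exists_sublist_wordPerm_eq_swap_mul l _ _ (lo_lt_hi j) h
    have := hl.2 m (hp.trans (wordPerm_cons j l).symm)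
    simp only [List.length_cons] at this
    omega
  · refine ⟨by rw [wordPerm_cons, simple_mul_simple_mul]; rfl, fun m hm => ?_⟩
    have := hl.2 (j :: m) (by
      change wordPerm m = _ at hm
      change wordPerm (j :: m) = _
      simp [hm])
    simpa using this

lemma simple_simple_comm {j k : Fin (n - 1)} (h : j.1 + 2 ≤ k.1 ∨ k.1 + 2 ≤ j.1) :
    simple n j * simple n k = simple n k * simple n j := by
  apply Equiv.Perm.Disjoint.commute
  rw [Equiv.Perm.disjoint_iff_disjoint_support]
  simp only [simple, Equiv.Perm.support_swap (lo_lt_hi _).ne]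
  rw [Finset.disjoint_left]
  intro x
  simp only [Finset.mem_insert, Finset.mem_singleton, Fin.ext_iff, lo, hi]
  omega

lemma simple_apply_of_ne {j : Fin (n - 1)} {a : Fin n} (h₁ : a ≠ lo n j) (h₂ : a ≠ hi n j) :
    simple n j a = a := Equiv.swap_apply_of_ne_of_ne h₁ h₂

lemma simple_braid {j k : Fin (n - 1)} (h : k.1 = j.1 + 1) :
    simple n j * (simple n k * simple n j) = simple n k * (simple n j * simple n k) := by
  have e : lo n k = hi n j := by simp [hi, lo, h]
  have e₁ : simple n j (hi n k) = hi n k := simple_apply_of_ne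
    (by simp [hi, lo, Fin.ext_iff]; omega) (by simp [hi, Fin.ext_iff]; omega)
  have e₂ : simple n k (lo n j) = lo n j := simple_apply_of_ne
    (by simp [lo, Fin.ext_iff]; omega) (by simp [hi, lo, Fin.ext_iff]; omega)
  have h₁ : simple n j * simple n k = Equiv.swap (lo n j) (hi n k) * simple n j := by
    conv_lhs => rw [simple.eq_def n k, Equiv.mul_swap_eq_swap_mul, e, simple_hi, e₁]
  have h₂ : simple n k * simple n j = Equiv.swap (lo n j) (hi n k) * simple n k := by
    conv_lhs => rw [simple.eq_def n j, Equiv.mul_swap_eq_swap_mul, ← e, simple_lo, e₂]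
  rw [← mul_assoc, ← mul_assoc, h₁, h₂, mul_assoc, mul_assoc, simple_mul_self, simple_mul_self]

/-- Matsumoto's theorem for the symmetric group. -/
theorem prod_map_eq_of_isReducedWord {M : Type*} [Monoid M] (f : Fin (n - 1) → M)
    (hbraid : ∀ j k : Fin (n - 1), k.1 = j.1 + 1 → f j * f k * f j = f k * f j * f k)
    (hcomm : ∀ j k : Fin (n - 1), j.1 + 2 ≤ k.1 ∨ k.1 + 2 ≤ j.1 → f j * f k = f k * f j)
    {w : Equiv.Perm (Fin n)} {l l' : List (Fin (n - 1))}
    (hl : IsReducedWord n w l) (hl' : IsReducedWord n w l') :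
    (l.map f).prod = (l'.map f).prod := by
  induction hN : l.length using Nat.strong_induction_on generalizing w l l' with
  | _ N ih =>
  have hlen : l.length = l'.length := le_antisymm (hl.2 _ hl'.1) (hl'.2 _ hl.1)
  have adjacent : ∀ (j k : Fin (n - 1)) (a b : List (Fin (n - 1))), k.1 = j.1 + 1 →
      IsReducedWord n w (j :: a) → IsReducedWord n w (k :: b) → a.length < N → b.length < N →
      f j * (a.map f).prod = f k * (b.map f).prod := by
    intro j k a b hjk hja hkb haN hbN
    obtain ⟨hj, ha⟩ := hja.of_cons
    obtain ⟨hk, hb⟩ := hkb.of_cons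
    have e : hi n j = lo n k := by simp [hi, lo, hjk]
    have e₁ : simple n j (hi n k) = hi n k := simple_apply_of_ne
      (by simp [hi, lo, Fin.ext_iff]; omega) (by simp [hi, Fin.ext_iff]; omega)
    have e₂ : simple n k (lo n j) = lo n j := simple_apply_of_ne
      (by simp [lo, Fin.ext_iff]; omega) (by simp [hi, lo, Fin.ext_iff]; omega)
    unfold IsLeftDescent at hj hk
    obtain ⟨c, -, hclen, hc, hkc⟩ := ha.exists_of_isLeftDescent (j := k) (by
      simp only [IsLeftDescent, mul_inv_rev, simple_inv, Equiv.Perm.mul_apply, e₁, ← e, simple_hi]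
      exact (e ▸ hk).trans hj)
    obtain ⟨d, -, hdlen, hd, hjd⟩ := hc.exists_of_isLeftDescent (j := j) (by
      simp only [IsLeftDescent, mul_inv_rev, simple_inv, Equiv.Perm.mul_apply, e₂, simple_lo]
      rw [e, simple_lo, e₁]
      exact hk)
    have hb' : IsReducedWord n (simple n k * w) (j :: k :: d) := hb.of_length_le (by
      have hd' : wordPerm d = _ := hd.1
      rw [wordPerm_cons, wordPerm_cons, hd']
      calc _ = simple n j * (simple n k * simple n j) * simple n k * simple n j * w := by
            simp only [mul_assoc]
        _ = _ := by rw [simple_braid hjk]; simp [mul_assoc]) (by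
      have := hja.2 _ hkb.1
      have := hkb.2 _ hja.1
      simp only [List.length_cons] at *
      omega)
    have h₁ := ih _ haN ha hkc rfl
    have h₂ := ih _ (by omega) hc hjd rfl
    have h₃ := ih _ hbN hb hb' rfl
    simp only [List.map_cons, List.prod_cons] at h₁ h₂ h₃
    rw [h₁, h₂, h₃]
    simp only [← mul_assoc]
    rw [hbraid j k hjk]
  match l, l', hlen with
  | [], [], _ => rfl
  | j :: a, k :: b, hlen =>
    simp only [List.length_cons, Nat.add_right_cancel_iff] at hlen hN
    simp only [List.map_cons, List.prod_cons]
    obtain ⟨hj, ha⟩ := hl.of_cons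
    obtain ⟨hk, hb⟩ := hl'.of_cons
    by_cases hjk : j = k
    · subst hjk
      rw [ih _ (by omega) ha hb rfl]
    by_cases h₁ : k.1 = j.1 + 1
    · exact adjacent j k a b h₁ hl hl' (by omega) (by omega)
    by_cases h₂ : j.1 = k.1 + 1
    · exact (adjacent k j b a h₂ hl' hl (by omega) (by omega)).symm
    have hfar : j.1 + 2 ≤ k.1 ∨ k.1 + 2 ≤ j.1 := by
      have := Fin.val_ne_of_ne hjk
      omega
    obtain ⟨c, -, hclen, hc, hkc⟩ := ha.exists_of_isLeftDescent (j := k) (by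
      simp only [IsLeftDescent, mul_inv_rev, simple_inv, Equiv.Perm.mul_apply]
      rw [simple_apply_of_ne, simple_apply_of_ne]
      · exact hk
      all_goals simp [hi, lo, Fin.ext_iff]; omega)
    have hb' : IsReducedWord n (simple n k * w) (j :: c) := hb.of_length_le (by
      have hc' : wordPerm c = _ := hc.1
      rw [wordPerm_cons, hc', ← mul_assoc, simple_simple_comm hfar, mul_assoc,
        simple_mul_simple_mul]) (by simp only [List.length_cons]; omega)
    have h₃ := ih _ (by omega) ha hkc rfl
    have h₄ := ih _ (by omega) hb hb' rfl
    simp only [List.map_cons, List.prod_cons] at h₃ h₄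
    rw [h₃, h₄, ← mul_assoc, ← mul_assoc, hcomm j k hfar]

end Words

section Algebra

variable {R : Type*} [CommRing R] {n r : ℕ} {q Δ : Rˣ} {u : Fin r → R} {F : Fin r → R[X]}

local notation "H" => Hnr R n r q Δ u F
local notation "A" => Algebra.adjoin R (Set.range (tt R n r q Δ u F))

lemma pim_eq_of_rel {x y : FA R n} (h : Rel R n r q Δ u F x y) :
    pim R n r q Δ u F x = pim R n r q Δ u F y := RingQuot.mkAlgHom_rel R h

lemma TT_braid (j k : Fin (n - 1)) (h : k.1 = j.1 + 1) :
    TT R n r q Δ u F j * TT R n r q Δ u F k * TT R n r q Δ u F j =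
      TT R n r q Δ u F k * TT R n r q Δ u F j * TT R n r q Δ u F k := by
  simpa only [map_mul] using! pim_eq_of_rel (Rel.braid (q := q) (Δ := Δ) (u := u) (F := F) j k h)

lemma TT_comm (j k : Fin (n - 1)) (h : j.1 + 2 ≤ k.1 ∨ k.1 + 2 ≤ j.1) :
    TT R n r q Δ u F j * TT R n r q Δ u F k = TT R n r q Δ u F k * TT R n r q Δ u F j := by
  simpa only [map_mul] using! pim_eq_of_rel (Rel.Tcomm (q := q) (Δ := Δ) (u := u) (F := F) j k h)

lemma TT_mul_self (j : Fin (n - 1)) :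
    TT R n r q Δ u F j * TT R n r q Δ u F j =
      algebraMap R H ((q : R) - ((q⁻¹ : Rˣ) : R)) * TT R n r q Δ u F j + 1 := by
  have h := pim_eq_of_rel (Rel.quad (q := q) (Δ := Δ) (u := u) (F := F) j)
  simp only [map_mul, map_sub, map_add, AlgHom.commutes, map_zero] at h
  change (TT R n r q Δ u F j - _) * (TT R n r q Δ u F j + _) = 0 at h
  rw [sub_mul, mul_add, mul_add, ← map_mul, Units.mul_inv, map_one, ← Algebra.commutes,
    sub_eq_zero, ← eq_sub_iff_add_eq] at h
  rw [h, map_sub, sub_mul]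
  abel

lemma Tword_cons (j : Fin (n - 1)) (l : List (Fin (n - 1))) :
    Tword R n r q Δ u F (j :: l) = TT R n r q Δ u F j * Tword R n r q Δ u F l := by
  simp [Tword]

lemma Tword_eq_of_isReducedWord {w : Equiv.Perm (Fin n)} {l l' : List (Fin (n - 1))}
    (hl : IsReducedWord n w l) (hl' : IsReducedWord n w l') :
    Tword R n r q Δ u F l = Tword R n r q Δ u F l' :=
  prod_map_eq_of_isReducedWord _ TT_braid TT_comm hl hl'

lemma aeval_tt_mem (i : Fin n) (p : R[X]) : aeval (tt R n r q Δ u F i) p ∈ A :=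
  Algebra.adjoin_mono (Set.singleton_subset_iff.2 (Set.mem_range_self i))
    (aeval_mem_adjoin_singleton R _)

lemma pim_Bel_mem (j : Fin (n - 1)) : pim R n r q Δ u F (Bel R n r q Δ u F j) ∈ A := by
  simp only [Bel, map_sum, map_smul, map_mul, ← Polynomial.aeval_algHom_apply]
  exact sum_mem fun c _ => sum_mem fun d _ =>
    Subalgebra.smul_mem _ (mul_mem (aeval_tt_mem _ _) (aeval_tt_mem _ _)) _

lemma B'_mem (i j : Fin n) : B' R n r q Δ u F i j ∈ A := by
  refine neg_mem (Subalgebra.smul_mem _ (sum_mem fun k _ => list_prod_mem fun x hx => ?_) _)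
  obtain ⟨i, rfl⟩ := (List.mem_ofFn' _ _).1 hx
  exact aeval_tt_mem _ _

lemma TT_mul_tt (j : Fin (n - 1)) (i : Fin n) :
    ∃ c ∈ A, TT R n r q Δ u F j * tt R n r q Δ u F i =
      tt R n r q Δ u F (simple n j i) * TT R n r q Δ u F j + c := by
  by_cases h₁ : i = lo n j
  · subst h₁
    refine ⟨-_, neg_mem (pim_Bel_mem j), ?_⟩
    rw [simple_lo, ← sub_eq_add_neg]
    simpa only [map_mul, map_sub] using!
      pim_eq_of_rel (Rel.Tlo (q := q) (Δ := Δ) (u := u) (F := F) j)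
  by_cases h₂ : i = hi n j
  · subst h₂
    refine ⟨_, pim_Bel_mem j, ?_⟩
    rw [simple_hi]
    simpa only [map_mul, map_add] using!
      pim_eq_of_rel (Rel.Thi (q := q) (Δ := Δ) (u := u) (F := F) j)
  · refine ⟨0, zero_mem _, ?_⟩
    rw [simple_apply_of_ne h₁ h₂, add_zero]
    simpa only [map_mul] using!
      pim_eq_of_rel (Rel.Tt (q := q) (Δ := Δ) (u := u) (F := F) j i h₁ h₂)

lemma exists_TT_mul_eq (j : Fin (n - 1)) {a : H} (ha : a ∈ A) :
    ∃ c ∈ A, ∃ d ∈ A, TT R n r q Δ u F j * a = c * TT R n r q Δ u F j + d := by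
  induction ha using Algebra.adjoin_induction with
  | mem x hx =>
    obtain ⟨i, rfl⟩ := hx
    obtain ⟨c, hc, h⟩ := TT_mul_tt (q := q) (Δ := Δ) (u := u) (F := F) j i
    exact ⟨_, Algebra.subset_adjoin (Set.mem_range_self _), c, hc, h⟩
  | algebraMap s =>
    exact ⟨_, algebraMap_mem _ s, 0, zero_mem _, by rw [add_zero, Algebra.commutes]⟩
  | add x y _ _ hx hy =>
    obtain ⟨c, hc, d, hd, h⟩ := hx
    obtain ⟨c', hc', d', hd', h'⟩ := hy
    exact ⟨_, add_mem hc hc', _, add_mem hd hd', by rw [mul_add, h, h', add_mul]; abel⟩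
  | mul x y _ hy' hx hy =>
    obtain ⟨c, hc, d, hd, h⟩ := hx
    obtain ⟨c', hc', d', hd', h'⟩ := hy
    exact ⟨_, mul_mem hc hc', _, add_mem (mul_mem hc hd') (mul_mem hd hy'), by
      rw [← mul_assoc, h, add_mul, mul_assoc c, h']; simp only [mul_add, mul_assoc, add_assoc]⟩

/-- `g_l - T_l` is a combination of the `T_m` for proper subwords `m` of `l`. -/
lemma gword_sub_Tword_mem_span (l : List (Fin (n - 1))) :
    gword R n r q Δ u F l - Tword R n r q Δ u F l ∈ Submodule.span R
      {x : H | ∃ a ∈ A, ∃ m : List (Fin (n - 1)), m.Sublist l ∧ m.length < l.length ∧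
        x = a * Tword R n r q Δ u F m} := by
  induction l with
  | nil => simp [gword, Tword]
  | cons j l ih =>
    have hg : gword R n r q Δ u F (j :: l) = g R n r q Δ u F j * gword R n r q Δ u F l := by
      simp [gword]
    rw [hg, Tword_cons, g]
    generalize hs : gword R n r q Δ u F l - Tword R n r q Δ u F l = s at ih
    rw [sub_eq_iff_eq_add.1 hs, add_mul, mul_add, mul_add, add_sub_right_comm, add_sub_cancel_right,
      ← add_assoc]
    refine add_mem ?_ (Submodule.subset_span ⟨_, B'_mem _ _, l, List.sublist_cons_self _ _,
      by simp, rfl⟩)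
    clear hs
    induction ih using Submodule.span_induction with
    | mem x hx =>
      obtain ⟨a, ha, m, hm, hlen, rfl⟩ := hx
      obtain ⟨c, hc, d, hd, h⟩ := exists_TT_mul_eq j ha
      rw [← mul_assoc, h, add_mul, mul_assoc c, ← Tword_cons]
      refine add_mem (add_mem ?_ ?_) ?_
      · exact Submodule.subset_span ⟨c, hc, j :: m, hm.cons_cons j, by simpa using hlen, rfl⟩
      · exact Submodule.subset_span ⟨d, hd, m, hm.cons j, by simp; omega, rfl⟩
      · exact Submodule.subset_span ⟨_, mul_mem (B'_mem _ _) ha, m, hm.cons j, by simp; omega,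
          (mul_assoc _ _ _).symm⟩
    | zero => simp
    | add x y _ _ hx hy =>
      rw [mul_add, mul_add, add_add_add_comm]
      exact add_mem hx hy
    | smul t x _ hx =>
      simpa only [mul_smul_comm, ← smul_add] using Submodule.smul_mem _ t hx

/-- `T_l` is a combination of the `T_w` for those `w` having a reduced word inside `l`. -/
lemma Tword_mem_span (l : List (Fin (n - 1))) :
    Tword R n r q Δ u F l ∈ Submodule.span R
      {x : H | ∃ (w : Equiv.Perm (Fin n)) (m : List (Fin (n - 1))),
        m.Sublist l ∧ IsReducedWord n w m ∧ x = Tword R n r q Δ u F m} := by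
  induction l with
  | nil => exact Submodule.subset_span ⟨1, [], List.Sublist.refl _, ⟨rfl, by simp⟩, rfl⟩
  | cons j l ih =>
    rw [Tword_cons]
    generalize Tword R n r q Δ u F l = s at ih
    induction ih using Submodule.span_induction with
    | mem x hx =>
      obtain ⟨w, m, hm, hw, rfl⟩ := hx
      by_cases hj : IsLeftDescent j w
      · obtain ⟨m', hm', -, hw', hjm'⟩ := hw.exists_of_isLeftDescent hj
        rw [Tword_eq_of_isReducedWord hw hjm', Tword_cons, ← mul_assoc, TT_mul_self, add_mul,
          one_mul, mul_assoc, ← Tword_cons, ← Algebra.smul_def, ← Tword_eq_of_isReducedWord hw hjm']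
        exact add_mem
          (Submodule.smul_mem _ _ (Submodule.subset_span ⟨w, m, hm.cons j, hw, rfl⟩))
          (Submodule.subset_span ⟨_, m', (hm'.trans hm).cons j, hw', rfl⟩)
      · exact Submodule.subset_span ⟨_, j :: m, hm.cons_cons j, hw.cons hj, (Tword_cons j m).symm⟩
    | zero => simp
    | add x y _ _ hx hy => rw [mul_add]; exact add_mem hx hy
    | smul t x _ hx => rw [mul_smul_comm]; exact Submodule.smul_mem _ t hx

end Algebra

end MAK

/-- Lemma 3.9: `g_w ∈ T_w + ∑_{w' < w} R[t_1,…,t_n] T_{w'}`. -/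
theorem statement7
    (R : Type*) [CommRing R] [IsDomain R] (n r : ℕ) (hn : 1 ≤ n) (hr : 1 ≤ r)
    (q Δ : Rˣ) (u : Fin r → R) (F : Fin r → R[X])
    (hΔ : (Δ : R) = ∏ i : Fin r, ∏ j ∈ Finset.univ.filter (fun j => j < i), (u i - u j))
    (hFdeg : ∀ c : Fin r, (F c).degree = ((r - 1 : ℕ) : WithBot ℕ))
    (hFeval : ∀ c c' : Fin r, (F c).eval (u c') = if c' = c then (Δ : R) else 0)
    (w : Equiv.Perm (Fin n)) (l : List (Fin (n - 1))) (hl : IsReducedWord n w l) :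
    gword R n r q Δ u F l - Tword R n r q Δ u F l ∈
      Submodule.span R
        {x : Hnr R n r q Δ u F |
          ∃ a ∈ Algebra.adjoin R (Set.range (tt R n r q Δ u F)),
            ∃ (w' : Equiv.Perm (Fin n)) (l' : List (Fin (n - 1))),
              BruhatLT n w' w ∧ IsReducedWord n w' l' ∧ x = a * Tword R n r q Δ u F l'} := by
  refine Submodule.span_le.2 ?_ (gword_sub_Tword_mem_span l)
  rintro _ ⟨a, ha, m, hm, hlen, rfl⟩
  refine Submodule.span_induction (p := fun x _ => a * x ∈ _) ?_ ?_ ?_ ?_ (Tword_mem_span m)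
  · rintro _ ⟨w', m', hm', hw', rfl⟩
    refine Submodule.subset_span ⟨a, ha, w', m', ⟨⟨l, hl, m', hm'.trans hm, hw'⟩, ?_⟩, hw', rfl⟩
    rintro rfl
    have := hl.2 m' hw'.1
    have := hm'.length_le
    omega
  · simp
  · intro x y _ _ hx hy
    rw [mul_add]
    exact add_mem hx hy
  · intro t x _ hx
    rw [mul_smul_comm]
    exact Submodule.smul_mem _ t hx
end
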